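/- (Optimality, necessity of α₁ + α₂ > (d−1)/2.) Let d ≥ 2 and α₁, α₂ ≥ 0 with α₁ + α₂ ≤ (d−1)/2. Then for every α̃ ∈ ℝ and every α₀ ≥ 0, the Strichartz estimate ‖ |∇|^{α̃} ρ_{e^{itΔ} γ₀ e^{−itΔ}} ‖_{L²_t(ℝ; H^{α₀}_x)} ≤ C ‖⟨∇⟩^{α₁} γ₀ ⟨∇⟩^{α₂}‖_{𝔖²} fails: there is no finite constant C making it hold for all Hilbert–Schmidt operators γ₀ on L²(ℝ^d). -/

import Mathlib

open MeasureTheory Complex Filter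
open scoped ENNReal NNReal RealInnerProductSpace Topology ComplexConjugate

noncomputable section

/-- `d`-dimensional Euclidean space `ℝ^d`. -/
abbrev Vd (d : ℕ) := EuclideanSpace ℝ (Fin d)

/-- The Japanese bracket `⟨ξ⟩ = (1 + |ξ|²)^{1/2}`. -/
noncomputable def jb {d : ℕ} (ξ : Vd d) : ℝ := (1 + ‖ξ‖ ^ 2) ^ ((1 : ℝ) / 2)

/-- Fourier transform, with the paper's convention `ĥ(ξ) = ∫ e^{-i x·ξ} h(x) dx`. -/
noncomputable def ft {d : ℕ} (h : Vd d → ℂ) (ξ : Vd d) : ℂ :=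
  ∫ x : Vd d, Complex.exp (-(Complex.I * Complex.ofReal (⟪x, ξ⟫))) * h x

/-- Inverse Fourier transform `ǧ(x) = (2π)^{-d} ∫ e^{i x·ξ} g(ξ) dξ`. -/
noncomputable def invFt {d : ℕ} (h : Vd d → ℂ) (x : Vd d) : ℂ :=
  (((2 * Real.pi) ^ d)⁻¹ : ℝ) • ∫ ξ : Vd d, Complex.exp (Complex.I * Complex.ofReal (⟪x, ξ⟫)) * h ξ

/-- The space Fourier transform (at frequency `ξ`, time `t`) of the density of
`e^{itΔ} γ₀ e^{-itΔ}`, expressed via `G = γ̂₀`, the `2d`-dimensional Fourier transform of the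
integral kernel of `γ₀`:  `ρ̂(t,ξ) = (2π)^{-d} ∫ e^{-it(|η|²-|ξ-η|²)} G(η, ξ-η) dη`. -/
noncomputable def densFT {d : ℕ} (G : Vd d × Vd d → ℂ) (t : ℝ) (ξ : Vd d) : ℂ :=
  (((2 * Real.pi) ^ d)⁻¹ : ℝ) •
    ∫ η : Vd d, Complex.exp (-(Complex.I * Complex.ofReal (t * (‖η‖ ^ 2 - ‖ξ - η‖ ^ 2)))) * G (η, ξ - η)

/-- `‖ |∇|^s ρ_{e^{itΔ}γ₀e^{-itΔ}} ‖_{L²_t(ℝ; H^{α₀}_x)}`, computed on the space Fourier side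
(by Plancherel) from `G = γ̂₀`. -/
noncomputable def densStriNorm {d : ℕ} (s α₀ : ℝ) (G : Vd d × Vd d → ℂ) : ℝ≥0∞ :=
  (∫⁻ t : ℝ, ∫⁻ ξ : Vd d,
      ENNReal.ofReal (‖ξ‖ ^ (2 * s) * jb ξ ^ (2 * α₀)) * (‖densFT G t ξ‖₊ : ℝ≥0∞) ^ (2:ℝ)) ^ ((1:ℝ)/2)

/-- The weighted Hilbert–Schmidt norm `‖⟨∇⟩^{α₁} γ₀ ⟨∇⟩^{α₂}‖_{𝔖²}`, computed (by Plancherel)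
from `G = γ̂₀`. -/
noncomputable def wHSnorm {d : ℕ} (α₁ α₂ : ℝ) (G : Vd d × Vd d → ℂ) : ℝ≥0∞ :=
  (∫⁻ p : Vd d × Vd d,
      ENNReal.ofReal (jb p.1 ^ (2 * α₁) * jb p.2 ^ (2 * α₂)) * (‖G p‖₊ : ℝ≥0∞) ^ (2:ℝ)) ^ ((1:ℝ)/2)

/-- The box `|η_{i₀}| ≤ 1`, `|η_i| ≤ 2^N` for `i ≠ i₀`. -/
def slabBox {d : ℕ} (i₀ : Fin d) (N : ℕ) : Set (Vd d) :=
  {η | ∀ i, |η i| ≤ Function.update (fun _ => (2:ℝ) ^ N) i₀ 1 i}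

lemma slabBox_eq_preimage {d : ℕ} (i₀ : Fin d) (N : ℕ) :
    slabBox i₀ N = (WithLp.ofLp : Vd d → Fin d → ℝ) ⁻¹'
      Set.Icc (-Function.update (fun _ => (2:ℝ) ^ N) i₀ 1)
        (Function.update (fun _ => (2:ℝ) ^ N) i₀ 1) := by
  ext η
  simp only [slabBox, Set.mem_ofPred_eq, Set.mem_preimage, Set.mem_Icc, Pi.le_def, Pi.neg_apply,
    abs_le, forall_and]

lemma measurableSet_slabBox {d : ℕ} (i₀ : Fin d) (N : ℕ) : MeasurableSet (slabBox i₀ N) := by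
  rw [slabBox_eq_preimage]
  exact (PiLp.volume_preserving_ofLp (Fin d)).measurable measurableSet_Icc

lemma volume_slabBox {d : ℕ} (i₀ : Fin d) (N : ℕ) :
    volume (slabBox i₀ N) = ENNReal.ofReal (2 * (2 * 2 ^ N) ^ (d - 1)) := by
  rw [slabBox_eq_preimage,
    (PiLp.volume_preserving_ofLp (Fin d)).measure_preimage
      measurableSet_Icc.nullMeasurableSet, Real.volume_Icc_pi,
    ← ENNReal.ofReal_prod_of_nonneg]
  · congr 1
    rw [← Finset.mul_prod_erase _ _ (Finset.mem_univ i₀)]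
    have : ∀ i ∈ Finset.univ.erase i₀,
        Function.update (fun _ => (2:ℝ) ^ N) i₀ 1 i
          - (-Function.update (fun _ => (2:ℝ) ^ N) i₀ 1) i = 2 * 2 ^ N := by
      intro i hi
      rw [Pi.neg_apply, Function.update_of_ne (Finset.ne_of_mem_erase hi)]
      ring
    rw [Finset.prod_congr rfl this]
    simp only [Pi.neg_apply, Function.update_self, Finset.prod_const, Finset.mem_univ,
      Finset.card_erase_of_mem, Finset.card_univ, Fintype.card_fin]
    norm_num
  · intro i _
    rcases eq_or_ne i i₀ with rfl | h
    · simp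
    · rw [Pi.neg_apply, Function.update_of_ne h]
      have : (0:ℝ) < 2 ^ N := by positivity
      linarith

lemma abs_apply_le_of_mem_slabBox {d : ℕ} {i₀ : Fin d} {N : ℕ} {η : Vd d}
    (h : η ∈ slabBox i₀ N) (i : Fin d) : |η i| ≤ 2 ^ N := by
  have := h i
  rcases eq_or_ne i i₀ with rfl | hi
  · rw [Function.update_self] at this
    exact this.trans (one_le_pow₀ one_le_two)
  · rwa [Function.update_of_ne hi] at this

lemma slabBox_subset_succ {d : ℕ} (i₀ : Fin d) (N : ℕ) :
    slabBox i₀ N ⊆ slabBox i₀ (N + 1) := by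
  intro η h i
  rcases eq_or_ne i i₀ with rfl | hi
  · simpa using h i
  · rw [Function.update_of_ne hi]
    exact (abs_apply_le_of_mem_slabBox h i).trans (pow_le_pow_right₀ one_le_two N.le_succ)

lemma norm_sq_le_of_mem_slabBox {d : ℕ} {i₀ : Fin d} {N : ℕ} {η : Vd d}
    (h : η ∈ slabBox i₀ N) : ‖η‖ ^ 2 ≤ d * (2 ^ N) ^ 2 := by
  rw [EuclideanSpace.norm_sq_eq]
  calc ∑ i, ‖η i‖ ^ 2 ≤ ∑ _i : Fin d, ((2:ℝ) ^ N) ^ 2 :=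
        Finset.sum_le_sum fun i _ => by
          rw [Real.norm_eq_abs]
          have := abs_apply_le_of_mem_slabBox h i
          gcongr
    _ = d * (2 ^ N) ^ 2 := by simp

lemma norm_le_of_mem_slabBox {d : ℕ} {i₀ : Fin d} {N : ℕ} {η : Vd d}
    (h : η ∈ slabBox i₀ N) : ‖η‖ ≤ d * 2 ^ N := by
  have hd : (1:ℝ) ≤ d := by exact_mod_cast i₀.pos
  refine abs_le_of_sq_le_sq' ?_ (by positivity) |>.2
  refine (norm_sq_le_of_mem_slabBox h).trans ?_
  rw [mul_pow]
  gcongr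
  nlinarith

lemma jb_eq_sqrt {d : ℕ} (ξ : Vd d) : jb ξ = √(1 + ‖ξ‖ ^ 2) := (Real.sqrt_eq_rpow _).symm

lemma one_le_jb {d : ℕ} (ξ : Vd d) : 1 ≤ jb ξ := by
  rw [jb_eq_sqrt, Real.one_le_sqrt]
  nlinarith [sq_nonneg ‖ξ‖]

lemma jb_pos {d : ℕ} (ξ : Vd d) : 0 < jb ξ := one_pos.trans_le (one_le_jb ξ)

lemma continuous_jb {d : ℕ} : Continuous (jb : Vd d → ℝ) := by
  rw [show (jb : Vd d → ℝ) = fun ξ => √(1 + ‖ξ‖ ^ 2) from funext jb_eq_sqrt]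
  fun_prop

lemma jb_sub_le {d : ℕ} {ξ : Vd d} (hξ : ‖ξ‖ ≤ 2) (η : Vd d) : jb (ξ - η) ≤ 3 * jb η := by
  rw [jb_eq_sqrt, jb_eq_sqrt, Real.sqrt_le_left (by positivity), mul_pow,
    Real.sq_sqrt (by positivity)]
  nlinarith [norm_sub_le ξ η, norm_nonneg ξ, norm_nonneg η, norm_nonneg (ξ - η),
    sq_nonneg (‖η‖ - 1)]

lemma jb_le_of_mem_slabBox {d : ℕ} {i₀ : Fin d} {N : ℕ} {η : Vd d}
    (h : η ∈ slabBox i₀ N) : jb η ≤ 2 * d * 2 ^ N := by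
  have hd : (1:ℝ) ≤ d := by exact_mod_cast i₀.pos
  have h2 : (1:ℝ) ≤ 2 ^ N := one_le_pow₀ one_le_two
  have := norm_le_of_mem_slabBox h
  have h3 : (1:ℝ) ≤ d * 2 ^ N := by nlinarith
  rw [jb_eq_sqrt, Real.sqrt_le_left (by positivity)]
  nlinarith [norm_nonneg η]

lemma integrableOn_inv_jb_pow {d : ℕ} (i₀ : Fin d) (n N : ℕ) :
    IntegrableOn (fun η : Vd d => (jb η ^ n)⁻¹) (slabBox i₀ N) := by
  refine IntegrableOn.of_bound (C := 1) (by rw [volume_slabBox]; exact ENNReal.ofReal_lt_top) ?_ ?_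
  · exact ((continuous_jb.pow n).inv₀ fun η => (pow_pos (jb_pos η) n).ne').aestronglyMeasurable
  · refine ae_of_all _ fun η => ?_
    rw [Real.norm_of_nonneg (by have := jb_pos η; positivity)]
    exact inv_le_one_of_one_le₀ (one_le_pow₀ (one_le_jb η))

lemma setIntegral_slabBox_succ_ge {d : ℕ} (hd : 2 ≤ d) (i₀ : Fin d) (N : ℕ) :
    (∫ η in slabBox i₀ N, (jb η ^ (d - 1))⁻¹) + ((2 * d : ℝ) ^ (d - 1))⁻¹
      ≤ ∫ η in slabBox i₀ (N + 1), (jb η ^ (d - 1))⁻¹ := by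
  have hsub := slabBox_subset_succ i₀ N
  have hfin : ∀ M, volume (slabBox i₀ M) ≠ ⊤ := fun M => by
    rw [volume_slabBox]; exact ENNReal.ofReal_ne_top
  have hreal : ∀ M, volume.real (slabBox i₀ M) = 2 * (2 * 2 ^ M) ^ (d - 1) := fun M => by
    rw [measureReal_def, volume_slabBox, ENNReal.toReal_ofReal (by positivity)]
  have hd0 : (0:ℝ) < d := by exact_mod_cast i₀.pos
  have hint := integrableOn_inv_jb_pow i₀ (d - 1) (N + 1)
  rw [add_comm, ← le_sub_iff_add_le, ← setIntegral_sdiff (measurableSet_slabBox i₀ N) hint hsub]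
  have hshell := setIntegral_ge_of_const_le_real (μ := volume)
    (c := ((2 * d * 2 ^ (N + 1)) ^ (d - 1))⁻¹)
    ((measurableSet_slabBox i₀ (N + 1)).diff (measurableSet_slabBox i₀ N))
    (measure_ne_top_of_subset Set.sdiff_subset (hfin (N + 1)))
    (fun η hη => inv_anti₀ (pow_pos (jb_pos η) _)
      (pow_le_pow_left₀ (jb_pos η).le (jb_le_of_mem_slabBox hη.1) _))
    (hint.mono_set Set.sdiff_subset)
  refine le_trans ?_ hshell
  rw [measureReal_sdiff hsub (measurableSet_slabBox i₀ N) (hfin (N + 1)), hreal, hreal,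
    mul_pow (2 * d : ℝ), mul_inv, mul_assoc]
  refine le_mul_of_one_le_right (by positivity) ?_
  rw [inv_mul_eq_div, one_le_div (by positivity), pow_succ (2:ℝ) N]
  obtain ⟨n, hn⟩ : ∃ n, d - 1 = n + 1 := ⟨d - 2, by omega⟩
  simp only [hn, mul_pow, pow_succ _ n]
  have h2 : (1:ℝ) ≤ 2 ^ n := one_le_pow₀ one_le_two
  have h3 : (0:ℝ) < (2 ^ N) ^ n * 2 ^ N := by positivity
  nlinarith [mul_pos h3 (one_pos.trans_le h2), mul_nonneg h3.le (sub_nonneg.2 h2),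
    mul_nonneg h3.le (mul_nonneg (sub_nonneg.2 h2) (sub_nonneg.2 h2))]

lemma tendsto_setIntegral_slabBox {d : ℕ} (hd : 2 ≤ d) (i₀ : Fin d) :
    Tendsto (fun N => ∫ η in slabBox i₀ N, (jb η ^ (d - 1))⁻¹) atTop atTop := by
  have hc : (0:ℝ) < ((2 * d : ℝ) ^ (d - 1))⁻¹ := by
    have : (0:ℝ) < d := by exact_mod_cast i₀.pos
    positivity
  refine tendsto_atTop_mono (f := fun N : ℕ => N * ((2 * d : ℝ) ^ (d - 1))⁻¹) (fun N => ?_)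
    (tendsto_natCast_atTop_atTop.atTop_mul_const hc)
  induction N with
  | zero =>
    simp only [Nat.cast_zero, zero_mul]
    exact integral_nonneg fun η => by have := jb_pos η; positivity
  | succ N ih =>
    push_cast
    linarith [setIntegral_slabBox_succ_ge hd i₀ N]

/-- A ball of frequencies around the `i₀`-th unit vector, so small that `η·ξ` stays bounded
for `η ∈ slabBox i₀ N`. -/
def freqBall {d : ℕ} (i₀ : Fin d) (N : ℕ) : Set (Vd d) :=
  Metric.closedBall (EuclideanSpace.single i₀ 1) (2 * (d * 2 ^ N) : ℝ)⁻¹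

lemma measurableSet_freqBall {d : ℕ} (i₀ : Fin d) (N : ℕ) : MeasurableSet (freqBall i₀ N) :=
  Metric.isClosed_closedBall.measurableSet

lemma norm_sub_single_le {d : ℕ} {i₀ : Fin d} {N : ℕ} {ξ : Vd d} (h : ξ ∈ freqBall i₀ N) :
    ‖ξ - EuclideanSpace.single i₀ 1‖ ≤ (2 * (d * 2 ^ N) : ℝ)⁻¹ := by
  rwa [← dist_eq_norm]

lemma norm_mem_Icc_of_mem_freqBall {d : ℕ} {i₀ : Fin d} {N : ℕ} {ξ : Vd d}
    (h : ξ ∈ freqBall i₀ N) : ‖ξ‖ ∈ Set.Icc (1 / 2) 2 := by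
  have hd : (1:ℝ) ≤ d := by exact_mod_cast i₀.pos
  have h2 : (1:ℝ) ≤ 2 ^ N := one_le_pow₀ one_le_two
  have h3 : (2 * (d * 2 ^ N) : ℝ)⁻¹ ≤ 2⁻¹ := inv_anti₀ two_pos (by nlinarith)
  have h4 := (abs_norm_sub_norm_le ξ (EuclideanSpace.single i₀ (1:ℝ))).trans
    ((norm_sub_single_le h).trans h3)
  rw [PiLp.norm_single, norm_one, abs_le] at h4
  constructor <;> linarith

lemma abs_phase_le {d : ℕ} {i₀ : Fin d} {N : ℕ} {ξ η : Vd d}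
    (hξ : ξ ∈ freqBall i₀ N) (hη : η ∈ slabBox i₀ N) : |‖η‖ ^ 2 - ‖ξ - η‖ ^ 2| ≤ 8 := by
  have hd : (1:ℝ) ≤ d := by exact_mod_cast i₀.pos
  have h2 : (1:ℝ) ≤ 2 ^ N := one_le_pow₀ one_le_two
  have hξ2 := norm_mem_Icc_of_mem_freqBall hξ
  have h0 : |η i₀| ≤ 1 := by simpa using hη i₀
  have h1 : |⟪ξ - EuclideanSpace.single i₀ 1, η⟫| ≤ 1 / 2 := by
    refine (abs_real_inner_le_norm _ _).trans ?_
    calc _ ≤ (2 * (d * 2 ^ N) : ℝ)⁻¹ * (d * 2 ^ N) :=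
          mul_le_mul (norm_sub_single_le hξ) (norm_le_of_mem_slabBox hη) (norm_nonneg _)
            (by positivity)
      _ = 1 / 2 := by field_simp
  rw [inner_sub_left, EuclideanSpace.inner_single_left] at h1
  simp only [map_one, one_mul] at h1
  rw [norm_sub_sq_real]
  rw [abs_le] at *
  obtain ⟨ha, hb⟩ := hξ2
  constructor <;> nlinarith

/-- The test kernel `γ̂₀(η, ζ) = 1_{η + ζ ∈ freqBall} 1_{η ∈ slabBox} ⟨η⟩^{-(d-1)}`. -/
def testKernel {d : ℕ} (i₀ : Fin d) (N : ℕ) (p : Vd d × Vd d) : ℝ :=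
  (freqBall i₀ N).indicator 1 (p.1 + p.2) *
    (slabBox i₀ N).indicator (fun η => (jb η ^ (d - 1))⁻¹) p.1

lemma measurable_testKernel {d : ℕ} (i₀ : Fin d) (N : ℕ) :
    Measurable (testKernel i₀ N) := by
  refine Measurable.mul ?_ ?_
  · exact (measurable_one.indicator (measurableSet_freqBall i₀ N)).comp
      (measurable_fst.add measurable_snd)
  · exact (((continuous_jb.measurable.pow_const _).inv).indicator
      (measurableSet_slabBox i₀ N)).comp measurable_fst

lemma norm_densFT_testKernel_ge {d : ℕ} (i₀ : Fin d) (N : ℕ) {ξ : Vd d} {t : ℝ}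
    (hξ : ξ ∈ freqBall i₀ N) (ht : |t| ≤ 1 / 8) :
    ((2 * Real.pi) ^ d)⁻¹ / 2 * ∫ η in slabBox i₀ N, (jb η ^ (d - 1))⁻¹
      ≤ ‖densFT (fun p => (testKernel i₀ N p : ℂ)) t ξ‖ := by
  have hπ : (0:ℝ) ≤ ((2 * Real.pi) ^ d)⁻¹ := by have := Real.pi_pos; positivity
  set f : Vd d → ℝ := (slabBox i₀ N).indicator (fun η => (jb η ^ (d - 1))⁻¹) with hf
  have hfint : Integrable f :=
    (integrable_indicator_iff (measurableSet_slabBox i₀ N)).2 (integrableOn_inv_jb_pow i₀ _ N)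
  have hG : ∀ η, testKernel i₀ N (η, ξ - η) = f η := fun η => by
    simp [testKernel, hξ, hf]
  rw [densFT, norm_smul, Real.norm_of_nonneg hπ, div_mul_eq_mul_div, mul_div_assoc]
  refine mul_le_mul_of_nonneg_left ?_ hπ
  simp only [hG]
  set E : Vd d → ℂ := fun η =>
    Complex.exp (-(Complex.I * Complex.ofReal (t * (‖η‖ ^ 2 - ‖ξ - η‖ ^ 2)))) with hE
  have hEeq : ∀ η, E η = Complex.exp (((-(t * (‖η‖ ^ 2 - ‖ξ - η‖ ^ 2)) : ℝ) : ℂ) * Complex.I) :=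
    fun η => by rw [hE]; push_cast; ring_nf
  have hEint : Integrable (fun η => E η * (f η : ℂ)) := by
    refine hfint.ofReal.bdd_mul (c := 1) ?_ (ae_of_all _ fun η => ?_)
    · exact Continuous.aestronglyMeasurable (by fun_prop)
    · rw [hEeq, Complex.norm_exp_ofReal_mul_I]
  refine le_trans ?_ (Complex.re_le_norm _)
  rw [← integral_indicator (measurableSet_slabBox i₀ N), ← hf, ← integral_div,
    show (∫ η, E η * (f η : ℂ)).re = ∫ η, (E η * (f η : ℂ)).re from (integral_re hEint).symm]
  refine integral_mono (hfint.div_const 2) hEint.re fun η => ?_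
  simp only [Complex.re_mul_ofReal]
  by_cases hη : η ∈ slabBox i₀ N
  · have hpos : 0 ≤ f η := by
      rw [hf, Set.indicator_of_mem hη]; have := jb_pos η; positivity
    have hcos : (1:ℝ) / 2 ≤ (E η).re := by
      rw [hEeq, Complex.exp_ofReal_mul_I_re, Real.cos_neg]
      refine le_trans ?_ Real.one_sub_sq_div_two_le_cos
      have : |t * (‖η‖ ^ 2 - ‖ξ - η‖ ^ 2)| ≤ 1 := by
        rw [abs_mul]
        nlinarith [abs_phase_le hξ hη, abs_nonneg t, abs_nonneg (‖η‖ ^ 2 - ‖ξ - η‖ ^ 2)]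
      nlinarith [(sq_le_one_iff_abs_le_one _).2 this]
    show f η / 2 ≤ (E η).re * f η
    nlinarith
  · simp [hf, hη]

lemma rpow_two_sq_half (x : ℝ≥0∞) : (x ^ ((1:ℝ) / 2)) ^ 2 = x := by
  rw [← ENNReal.rpow_natCast, ← ENNReal.rpow_mul]
  norm_num

lemma min_rpow_le {x s : ℝ} (hx : x ∈ Set.Icc (1 / 2) 2) :
    min ((1 / 2 : ℝ) ^ s) (2 ^ s) ≤ x ^ s := by
  have hx0 : 0 < x := by linarith [hx.1]
  rcases le_total 0 s with hs | hs
  · exact (min_le_left _ _).trans (Real.rpow_le_rpow (by norm_num) hx.1 hs)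
  · exact (min_le_right _ _).trans (Real.rpow_le_rpow_of_nonpos hx0 hx.2 hs)

lemma densStriNorm_testKernel_sq_ge {d : ℕ} (s α₀ : ℝ) (h₀ : 0 ≤ α₀) (i₀ : Fin d) (N : ℕ) :
    ENNReal.ofReal (1 / 4) * (ENNReal.ofReal (min ((1 / 2 : ℝ) ^ (2 * s)) (2 ^ (2 * s)) *
        (((2 * Real.pi) ^ d)⁻¹ / 2 * ∫ η in slabBox i₀ N, (jb η ^ (d - 1))⁻¹) ^ 2) *
      volume (freqBall i₀ N))
      ≤ densStriNorm s α₀ (fun p : Vd d × Vd d => (testKernel i₀ N p : ℂ)) ^ 2 := by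
  rw [densStriNorm, rpow_two_sq_half]
  set J := ((2 * Real.pi) ^ d)⁻¹ / 2 * ∫ η in slabBox i₀ N, (jb η ^ (d - 1))⁻¹ with hJ
  have hJ0 : 0 ≤ J := mul_nonneg (by have := Real.pi_pos; positivity)
    (integral_nonneg fun η => by have := jb_pos η; positivity)
  set m := min ((1 / 2 : ℝ) ^ (2 * s)) (2 ^ (2 * s))
  have hvol : ENNReal.ofReal (1 / 4) = volume (Set.Icc (-(1 / 8) : ℝ) (1 / 8)) := by
    rw [Real.volume_Icc]; norm_num
  rw [hvol, mul_comm, ← setLIntegral_const]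
  refine (setLIntegral_mono' measurableSet_Icc fun t ht => ?_).trans (setLIntegral_le_lintegral _ _)
  rw [← setLIntegral_const]
  refine (setLIntegral_mono' (measurableSet_freqBall i₀ N) fun ξ hξ => ?_).trans
    (setLIntegral_le_lintegral _ _)
  have hm0 : 0 ≤ m := by positivity
  rw [ENNReal.ofReal_mul hm0, ENNReal.ofReal_pow hJ0, ENNReal.rpow_two]
  gcongr
  · refine (min_rpow_le (norm_mem_Icc_of_mem_freqBall hξ)).trans ?_
    exact le_mul_of_one_le_right (by positivity) (Real.one_le_rpow (one_le_jb ξ) (by positivity))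
  · rw [← enorm_eq_nnnorm, ← ofReal_norm]
    exact ENNReal.ofReal_le_ofReal (norm_densFT_testKernel_ge i₀ N hξ (abs_le.2 ht))

lemma lintegral_prod_eq_lintegral_sub {d : ℕ} {F : Vd d × Vd d → ℝ≥0∞} (hF : Measurable F) :
    ∫⁻ p, F p = ∫⁻ ξ : Vd d, ∫⁻ η : Vd d, F (η, ξ - η) := by
  rw [Measure.volume_eq_prod, lintegral_prod _ hF.aemeasurable]
  rw [lintegral_lintegral_swap (f := fun ξ η => F (η, ξ - η)) (by
    exact (hF.comp (by fun_prop : Measurable fun p : Vd d × Vd d => (p.2, p.1 - p.2))).aemeasurable)]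
  refine lintegral_congr fun η => ?_
  exact (lintegral_sub_right_eq_self (fun ζ => F (η, ζ)) η).symm

lemma wHSnorm_testKernel_sq_le {d : ℕ} {α₁ α₂ : ℝ} (h₂ : 0 ≤ α₂)
    (hsum : α₁ + α₂ ≤ ((d:ℝ) - 1) / 2) (i₀ : Fin d) (N : ℕ) :
    wHSnorm α₁ α₂ (fun p : Vd d × Vd d => (testKernel i₀ N p : ℂ)) ^ 2
      ≤ ENNReal.ofReal (3 ^ (2 * α₂) * ∫ η in slabBox i₀ N, (jb η ^ (d - 1))⁻¹) *
        volume (freqBall i₀ N) := by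
  rw [wHSnorm, rpow_two_sq_half, lintegral_prod_eq_lintegral_sub]
  · rw [← setLIntegral_const, ← lintegral_indicator (measurableSet_freqBall i₀ N)]
    refine lintegral_mono fun ξ => ?_
    by_cases hξ : ξ ∈ freqBall i₀ N
    · rw [Set.indicator_of_mem hξ, ← integral_const_mul,
        ofReal_integral_eq_lintegral_ofReal ((integrableOn_inv_jb_pow i₀ _ N).const_mul _)
          (ae_of_all _ fun η => by have := jb_pos η; positivity),
        ← lintegral_indicator (measurableSet_slabBox i₀ N)]
      refine lintegral_mono fun η => ?_
      by_cases hη : η ∈ slabBox i₀ N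
      · have hj := jb_pos η
        have hk : testKernel i₀ N (η, ξ - η) = (jb η ^ (d - 1))⁻¹ := by
          simp [testKernel, hξ, hη]
        have hk0 : 0 < jb η ^ (d - 1) := by positivity
        rw [Set.indicator_of_mem hη]
        dsimp only
        rw [hk, ← enorm_eq_nnnorm, ← ofReal_norm, Complex.norm_real,
          Real.norm_of_nonneg (by positivity), ENNReal.ofReal_rpow_of_nonneg (by positivity) two_pos.le,
          ← ENNReal.ofReal_mul (by have := jb_pos (ξ - η); positivity)]
        refine ENNReal.ofReal_le_ofReal ?_
        have hw : jb η ^ (2 * α₁) * jb (ξ - η) ^ (2 * α₂) ≤ 3 ^ (2 * α₂) * jb η ^ (d - 1) := by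
          calc jb η ^ (2 * α₁) * jb (ξ - η) ^ (2 * α₂)
              ≤ jb η ^ (2 * α₁) * (3 * jb η) ^ (2 * α₂) := by
                have := jb_pos (ξ - η)
                gcongr
                exact jb_sub_le (norm_mem_Icc_of_mem_freqBall hξ).2 η
            _ = 3 ^ (2 * α₂) * jb η ^ (2 * α₁ + 2 * α₂) := by
                rw [Real.mul_rpow (by norm_num) hj.le, Real.rpow_add hj]; ring
            _ ≤ 3 ^ (2 * α₂) * jb η ^ (((d - 1 : ℕ)) : ℝ) := by
                gcongr
                · exact one_le_jb η
                · rw [Nat.cast_pred i₀.pos]; linarith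
            _ = _ := by rw [Real.rpow_natCast]
        calc _ ≤ (3 ^ (2 * α₂) * jb η ^ (d - 1)) * ((jb η ^ (d - 1))⁻¹) ^ (2:ℝ) := by gcongr
          _ = _ := by
            rw [Real.rpow_two]; field_simp
      · simp [testKernel, hη]
    · simp [testKernel, hξ]
  · have := (continuous_jb (d := d)).measurable
    have := measurable_testKernel i₀ N
    fun_prop

/-- optimality: necessity of `α₁ + α₂ > (d-1)/2`.  If `d ≥ 2` and
`α₁ + α₂ ≤ (d-1)/2`, then for every `α̃ ∈ ℝ` and `α₀ ≥ 0` the Strichartz estimate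
`‖ |∇|^{α̃} ρ_{e^{itΔ}γ₀e^{-itΔ}} ‖_{L²_t H^{α₀}_x} ≤ C ‖⟨∇⟩^{α₁} γ₀ ⟨∇⟩^{α₂}‖_{𝔖²}`
fails: no finite constant works for all Hilbert–Schmidt `γ₀` (described through `G = γ̂₀`). -/
theorem optimality_sum_condition
    (d : ℕ) (hd : 2 ≤ d) (α₁ α₂ : ℝ) (h₁ : 0 ≤ α₁) (h₂ : 0 ≤ α₂)
    (hsum : α₁ + α₂ ≤ ((d:ℝ) - 1) / 2) (s : ℝ) (α₀ : ℝ) (h₀ : 0 ≤ α₀) :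
    ¬ ∃ C : ℝ≥0, ∀ G : Vd d × Vd d → ℂ, AEStronglyMeasurable G volume →
        densStriNorm s α₀ G ≤ C * wHSnorm α₁ α₂ G := by
  rintro ⟨C, hC⟩
  let i₀ : Fin d := ⟨0, by omega⟩
  set m := min ((1 / 2 : ℝ) ^ (2 * s)) (2 ^ (2 * s)) with hm
  have hm0 : 0 < m := by positivity
  set c : ℝ := ((2 * Real.pi) ^ d)⁻¹ / 2 with hc
  have hc0 : 0 < c := by have := Real.pi_pos; positivity
  obtain ⟨N, hN0, hN⟩ := ((tendsto_setIntegral_slabBox hd i₀).eventually_gt_atTop 0 |>.and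
    ((tendsto_setIntegral_slabBox hd i₀).eventually_gt_atTop
      (C ^ 2 * 3 ^ (2 * α₂) / (1 / 4 * m * c ^ 2)))).exists
  have hlow := densStriNorm_testKernel_sq_ge s α₀ h₀ i₀ N
  have hup := wHSnorm_testKernel_sq_le h₂ hsum i₀ N
  have hmeas : AEStronglyMeasurable (fun p : Vd d × Vd d => (testKernel i₀ N p : ℂ)) volume :=
    (Complex.measurable_ofReal.comp (measurable_testKernel i₀ N)).aestronglyMeasurable
  have hle := pow_le_pow_left₀ (zero_le) (hC _ hmeas) 2
  rw [mul_pow] at hle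
  rw [← hm, ← hc] at hlow
  set J := ∫ η in slabBox i₀ N, (jb η ^ (d - 1))⁻¹
  have hchain := (hlow.trans hle).trans (mul_le_mul_right hup ((C : ℝ≥0∞) ^ 2))
  have hv0 : volume (freqBall i₀ N) ≠ 0 :=
    (Metric.measure_closedBall_pos _ _ (by
      have : (0:ℝ) < d := by exact_mod_cast i₀.pos
      positivity)).ne'
  have hvt : volume (freqBall i₀ N) ≠ ⊤ := measure_closedBall_lt_top.ne
  rw [← mul_assoc, ← mul_assoc, ENNReal.mul_le_mul_iff_left hv0 hvt,
    ← ENNReal.ofReal_mul (by norm_num), ← ENNReal.ofReal_coe_nnreal, ← ENNReal.ofReal_pow C.coe_nonneg,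
    ← ENNReal.ofReal_mul (by positivity), ENNReal.ofReal_le_ofReal_iff (by positivity)] at hchain
  rw [div_lt_iff₀ (by positivity)] at hN
  nlinarith
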